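/- arXiv:2105.14714 — 3 statements merged into one kernel-verified Lean document; each statement's English description precedes it below -/
import Mathlib

section
/- Under the structure conditions, the admissible space Ω^E_{ijk} ⊂ ℝ³ of Euclidean discrete conformal structures for the triangle {i,j,k} is nonempty and, as a topological subspace of ℝ³, simply connected (in particular path-connected). -/
open Real

/-- Euclidean discrete conformal edge length between vertices `s` and `t` of the triangle,
for scheme coefficients `ε`, conformal structure coefficients `η` and conformal factors `f`. -/
noncomputable def lE (ε : Fin 3 → ℝ) (η : Fin 3 → Fin 3 → ℝ) (f : Fin 3 → ℝ)
    (s t : Fin 3) : ℝ :=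
  Real.sqrt (ε s * exp (2 * f s) + ε t * exp (2 * f t) + 2 * η s t * exp (f s + f t))

/-- The admissible space `Ω^E_{ijk}`: conformal factors for which the three edge lengths
satisfy the three strict triangle inequalities. -/
def OmegaE (ε : Fin 3 → ℝ) (η : Fin 3 → Fin 3 → ℝ) : Set (Fin 3 → ℝ) :=
  {f | ∀ s t r : Fin 3, s ≠ t → s ≠ r → t ≠ r →
    lE ε η f s t + lE ε η f s r > lE ε η f t r}

/-- The inner angle at the vertex `a` of the Euclidean triangle, via the law of cosines.
The two other vertices of the triangle are `a + 1` and `a + 2` (cyclically in `Fin 3`). -/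
noncomputable def thetaE (ε : Fin 3 → ℝ) (η : Fin 3 → Fin 3 → ℝ) (f : Fin 3 → ℝ)
    (a : Fin 3) : ℝ :=
  arccos ((lE ε η f a (a + 1) ^ 2 + lE ε η f a (a + 2) ^ 2 - lE ε η f (a + 1) (a + 2) ^ 2) /
    (2 * lE ε η f a (a + 1) * lE ε η f a (a + 2)))

/-- The structure conditions on the weights of the triangle. -/
def StructCondE (ε : Fin 3 → ℝ) (η : Fin 3 → Fin 3 → ℝ) : Prop :=
  (∀ s, ε s = 0 ∨ ε s = 1) ∧ (∀ s t, η s t = η t s) ∧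
  (∀ s t : Fin 3, s ≠ t → ε s * ε t + η s t > 0) ∧
  (∀ q s t : Fin 3, q ≠ s → q ≠ t → s ≠ t → ε q * η s t + η q s * η q t ≥ 0)

/-- The bilinear form of the adjugate of the matrix with diagonal entries `ε s` and off-diagonal
entries `-η s t`, on the vertices `i`, `j`, `k`. -/
def adjForm (ε : Fin 3 → ℝ) (η : Fin 3 → Fin 3 → ℝ) (i j k : Fin 3) (u v : Fin 3 → ℝ) : ℝ :=
  (ε j * ε k - η j k ^ 2) * (u i * v i) + (ε k * ε i - η k i ^ 2) * (u j * v j) +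
    (ε i * ε j - η i j ^ 2) * (u k * v k) +
    (ε i * η j k + η i j * η k i) * (u j * v k + u k * v j) +
    (ε j * η k i + η j k * η i j) * (u k * v i + u i * v k) +
    (ε k * η i j + η k i * η j k) * (u i * v j + u j * v i)

lemma adjForm_rotate (ε : Fin 3 → ℝ) (η : Fin 3 → Fin 3 → ℝ) (i j k : Fin 3)
    (u v : Fin 3 → ℝ) : adjForm ε η i j k u v = adjForm ε η j k i u v := by
  unfold adjForm; ring

/-- Expansion of `adjForm` on a linear combination. -/
lemma adjForm_combo (ε : Fin 3 → ℝ) (η : Fin 3 → Fin 3 → ℝ) (i j k : Fin 3)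
    (u v : Fin 3 → ℝ) (a b : ℝ) :
    adjForm ε η i j k (a • u + b • v) (a • u + b • v) =
      a ^ 2 * adjForm ε η i j k u u + 2 * (a * b) * adjForm ε η i j k u v +
        b ^ 2 * adjForm ε η i j k v v := by
  simp only [adjForm, Pi.add_apply, Pi.smul_apply, smul_eq_mul]; ring

/-- The determinant of the matrix with diagonal entries `ε s` and off-diagonal entries `-η s t`. -/
def weightDet (ε : Fin 3 → ℝ) (η : Fin 3 → Fin 3 → ℝ) (i j k : Fin 3) : ℝ :=
  ε i * ε j * ε k - 2 * η i j * η j k * η k i - ε i * η j k ^ 2 - ε j * η k i ^ 2 -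
    ε k * η i j ^ 2

/-- Completing the square in the `i`-th variable. -/
lemma adjForm_complete_square (ε : Fin 3 → ℝ) (η : Fin 3 → Fin 3 → ℝ) (i j k : Fin 3)
    (u v : Fin 3 → ℝ) :
    (η j k ^ 2 - ε j * ε k) * adjForm ε η i j k u v =
      -weightDet ε η i j k *
        (ε k * (u j * v j) + ε j * (u k * v k) + η j k * (u j * v k + u k * v j)) -
      ((η j k ^ 2 - ε j * ε k) * u i - (ε k * η i j + η k i * η j k) * u j -
          (ε j * η k i + η j k * η i j) * u k) *
        ((η j k ^ 2 - ε j * ε k) * v i - (ε k * η i j + η k i * η j k) * v j -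
          (ε j * η k i + η j k * η i j) * v k) := by
  unfold adjForm weightDet; ring

section StructCond

variable {ε : Fin 3 → ℝ} {η : Fin 3 → Fin 3 → ℝ}

lemma StructCondE.weight_nonneg (h : StructCondE ε η) (s : Fin 3) : 0 ≤ ε s := by
  rcases h.1 s with hs | hs <;> simp [hs]

lemma StructCondE.eta_pos_or (h : StructCondE ε η) {s t : Fin 3} (hst : s ≠ t) :
    0 < η s t ∨ (ε s = 1 ∧ ε t = 1 ∧ -1 < η s t) := by
  have h1 := h.2.2.1 s t hst
  rcases h.1 s with hs | hs <;> rcases h.1 t with ht | ht <;> rw [hs, ht] at h1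
  · left; linarith
  · left; linarith
  · left; linarith
  · right; exact ⟨hs, ht, by linarith⟩

lemma StructCondE.eta_pos (h : StructCondE ε η) {s t : Fin 3} (hst : s ≠ t)
    (hn : ε s * ε t - η s t ^ 2 < 0) : 0 < η s t := by
  rcases h.eta_pos_or hst with h1 | ⟨hs, ht, h1⟩
  · exact h1
  · rw [hs, ht] at hn
    by_contra h0
    nlinarith

/-- The quadratic polynomial defining the squared edge lengths is positive. -/
lemma StructCondE.edge_pos (h : StructCondE ε η) {s t : Fin 3} (hst : s ≠ t) {x y : ℝ}
    (hx : 0 < x) (hy : 0 < y) : 0 < ε s * x ^ 2 + ε t * y ^ 2 + 2 * η s t * (x * y) := by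
  have hxy := mul_pos hx hy
  rcases h.eta_pos_or hst with h1 | ⟨hs, ht, h1⟩
  · have := h.weight_nonneg s
    have := h.weight_nonneg t
    positivity
  · rw [hs, ht]
    nlinarith [sq_nonneg (x - y), mul_pos (by linarith : 0 < η s t + 1) hxy]

lemma StructCondE.cross_nonneg (h : StructCondE ε η) {q s t : Fin 3} (hqs : q ≠ s) (hqt : q ≠ t)
    (hst : s ≠ t) : 0 ≤ ε q * η s t + η q s * η t q := by
  rw [h.2.1 t q]; exact h.2.2.2 q s t hqs hqt hst

lemma StructCondE.adjForm_nonneg_of_neg (h : StructCondE ε η) {i j k : Fin 3} (hjk : j ≠ k)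
    (hn : ε j * ε k - η j k ^ 2 < 0) {u v : Fin 3 → ℝ} (hu : ∀ s, 0 < u s) (hv : ∀ s, 0 < v s)
    (hqu : 0 < adjForm ε η i j k u u) (hqv : 0 < adjForm ε η i j k v v) :
    0 ≤ adjForm ε η i j k u v := by
  have hη := h.eta_pos hjk hn
  have hc : 0 < η j k ^ 2 - ε j * ε k := by linarith
  have e1 := adjForm_complete_square ε η i j k u u
  have e2 := adjForm_complete_square ε η i j k v v
  have e3 := adjForm_complete_square ε η i j k u v
  have p1 := mul_pos hc hqu
  have p2 := mul_pos hc hqv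
  have hj := h.weight_nonneg j
  have hk := h.weight_nonneg k
  have huj := hu j
  have huk := hu k
  have hvj := hv j
  have hvk := hv k
  refine nonneg_of_mul_nonneg_right ?_ hc
  rw [e1] at p1
  rw [e2] at p2
  rw [e3]
  clear e1 e2 e3
  set l := (η j k ^ 2 - ε j * ε k) * u i - (ε k * η i j + η k i * η j k) * u j -
    (ε j * η k i + η j k * η i j) * u k
  set m := (η j k ^ 2 - ε j * ε k) * v i - (ε k * η i j + η k i * η j k) * v j -
    (ε j * η k i + η j k * η i j) * v k
  set d := -weightDet ε η i j k
  have hL : (ε k * (u j * u j) + ε j * (u k * u k) + η j k * (u j * u k + u k * u j)) *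
      (ε k * (v j * v j) + ε j * (v k * v k) + η j k * (v j * v k + v k * v j)) ≤
      (ε k * (u j * v j) + ε j * (u k * v k) + η j k * (u j * v k + u k * v j)) ^ 2 := by
    have := mul_nonneg hc.le (sq_nonneg (u j * v k - u k * v j))
    linarith
  have hU : 0 < ε k * (u j * u j) + ε j * (u k * u k) + η j k * (u j * u k + u k * u j) := by
    positivity
  have hM : 0 < ε k * (u j * v j) + ε j * (u k * v k) + η j k * (u j * v k + u k * v j) := by
    positivity
  generalize ε k * (u j * u j) + ε j * (u k * u k) + η j k * (u j * u k + u k * u j) = U at *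
  generalize ε k * (v j * v j) + ε j * (v k * v k) + η j k * (v j * v k + v k * v j) = V at *
  generalize ε k * (u j * v j) + ε j * (u k * v k) + η j k * (u j * v k + u k * v j) = M at *
  have hd : 0 < d := by
    have : 0 < d * U := by nlinarith [mul_self_nonneg l]
    exact pos_of_mul_pos_left this hU.le
  have hlm : (l * m) ^ 2 ≤ (d * M) ^ 2 := by
    calc (l * m) ^ 2 = (l * l) * (m * m) := by ring
      _ ≤ (d * U) * (d * V) :=
        mul_le_mul (by linarith) (by linarith) (mul_self_nonneg m)
          (by nlinarith [mul_self_nonneg l])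
      _ = d ^ 2 * (U * V) := by ring
      _ ≤ d ^ 2 * M ^ 2 := by gcongr
      _ = (d * M) ^ 2 := by ring
  have := abs_le_of_sq_le_sq' hlm (by positivity)
  linarith [this.2]

lemma StructCondE.adjForm_nonneg (h : StructCondE ε η) {u v : Fin 3 → ℝ}
    (hu : ∀ s, 0 < u s) (hv : ∀ s, 0 < v s)
    (hqu : 0 < adjForm ε η 0 1 2 u u) (hqv : 0 < adjForm ε η 0 1 2 v v) :
    0 ≤ adjForm ε η 0 1 2 u v := by
  have r (u v) : adjForm ε η 0 1 2 u v = adjForm ε η 1 2 0 u v := adjForm_rotate ..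
  have r' (u v) : adjForm ε η 0 1 2 u v = adjForm ε η 2 0 1 u v := by
    rw [r, adjForm_rotate]
  by_cases h0 : ε 1 * ε 2 - η 1 2 ^ 2 < 0
  · exact h.adjForm_nonneg_of_neg (by decide) h0 hu hv hqu hqv
  by_cases h1 : ε 2 * ε 0 - η 2 0 ^ 2 < 0
  · rw [r] at *
    exact h.adjForm_nonneg_of_neg (by decide) h1 hu hv hqu hqv
  by_cases h2 : ε 0 * ε 1 - η 0 1 ^ 2 < 0
  · rw [r'] at *
    exact h.adjForm_nonneg_of_neg (by decide) h2 hu hv hqu hqv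
  have g0 := h.cross_nonneg (q := 0) (s := 1) (t := 2) (by decide) (by decide) (by decide)
  have g1 := h.cross_nonneg (q := 1) (s := 2) (t := 0) (by decide) (by decide) (by decide)
  have g2 := h.cross_nonneg (q := 2) (s := 0) (t := 1) (by decide) (by decide) (by decide)
  have hu0 := hu 0
  have hu1 := hu 1
  have hu2 := hu 2
  have hv0 := hv 0
  have hv1 := hv 1
  have hv2 := hv 2
  push Not at h0 h1 h2
  unfold adjForm
  positivity

/-- The determinant is negative as soon as one of the diagonal cofactors is. -/
lemma StructCondE.weightDet_neg (h : StructCondE ε η) {i j k : Fin 3} (hij : i ≠ j) (hjk : j ≠ k)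
    (hki : k ≠ i) (hn : ε j * ε k - η j k ^ 2 < 0) : weightDet ε η i j k < 0 := by
  have hη := h.eta_pos hjk hn
  have cofactor_k : (ε j * η k i + η j k * η i j) ^ 2 -
      (ε j * ε k - η j k ^ 2) * (ε i * ε j - η i j ^ 2) = -ε j * weightDet ε η i j k := by
    unfold weightDet; ring
  have cofactor_j : (ε k * η i j + η k i * η j k) ^ 2 -
      (ε j * ε k - η j k ^ 2) * (ε k * ε i - η k i ^ 2) = -ε k * weightDet ε η i j k := by
    unfold weightDet; ring
  have expand : weightDet ε η i j k = ε i * (ε j * ε k - η j k ^ 2) -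
      η i j * (ε k * η i j + η k i * η j k) - η k i * (ε j * η k i + η j k * η i j) := by
    unfold weightDet; ring
  rcases lt_or_ge (η i j) 0 with hneg | hz
  · obtain h1 | ⟨hi, hj, h1⟩ := h.eta_pos_or hij
    · linarith
    rw [hi, hj] at cofactor_k
    rw [hj] at hn
    have : 0 < 1 * 1 - η i j ^ 2 := by nlinarith
    nlinarith [mul_pos_of_neg_of_neg hn (neg_neg_of_pos this)]
  rcases lt_or_ge (η k i) 0 with hneg | hy
  · obtain h1 | ⟨hk, hi, h1⟩ := h.eta_pos_or hki
    · linarith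
    rw [hi, hk] at cofactor_j
    rw [hk] at hn
    have : 0 < 1 * 1 - η k i ^ 2 := by nlinarith
    nlinarith [mul_pos_of_neg_of_neg hn (neg_neg_of_pos this)]
  have hj := h.weight_nonneg j
  have hk := h.weight_nonneg k
  have t1 : 0 ≤ η i j * (ε k * η i j) := by positivity
  have t2 : 0 ≤ η k i * (ε j * η k i) := by positivity
  have t3 : 0 ≤ η i j * (η k i * η j k) := by positivity
  rcases h.1 i with hi | hi
  · have a1 := h.2.2.1 i j hij
    have a2 := h.2.2.1 k i hki
    rw [hi] at a1 a2
    have : 0 < η i j * (η k i * η j k) := by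
      have : 0 < η i j := by linarith
      have : 0 < η k i := by linarith
      positivity
    rw [expand, hi]
    linarith
  · rw [expand, hi]
    linarith

lemma StructCondE.exists_adjForm_pos_of_neg (h : StructCondE ε η) {i j k : Fin 3} (hij : i ≠ j)
    (hjk : j ≠ k) (hki : k ≠ i) (hn : ε j * ε k - η j k ^ 2 < 0) :
    ∃ u : Fin 3 → ℝ, (∀ s, 0 < u s) ∧ 0 < adjForm ε η i j k u u := by
  have hη := h.eta_pos hjk hn
  have hd := h.weightDet_neg hij hjk hki hn
  have hc : 0 < η j k ^ 2 - ε j * ε k := by linarith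
  have gk := h.cross_nonneg hki hjk.symm hij
  have gj := h.cross_nonneg hjk hij.symm hki
  have hj := h.weight_nonneg j
  have hk := h.weight_nonneg k
  have hR : 0 < -weightDet ε η i j k * (ε k + ε j + 2 * η j k) :=
    mul_pos (by linarith) (by positivity)
  set lin := (ε k * η i j + η k i * η j k) + (ε j * η k i + η j k * η i j)
  obtain ⟨δ, hδ, hδR⟩ : ∃ δ > 0, δ ^ 2 < -weightDet ε η i j k * (ε k + ε j + 2 * η j k) :=
    ⟨√(-weightDet ε η i j k * (ε k + ε j + 2 * η j k) / 2), by positivity, by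
      rw [Real.sq_sqrt (by positivity)]; linarith⟩
  set w := (lin + δ) / (η j k ^ 2 - ε j * ε k)
  have hwc : (η j k ^ 2 - ε j * ε k) * w = lin + δ := mul_div_cancel₀ _ hc.ne'
  refine ⟨Function.update 1 i w, fun s => ?_, ?_⟩
  · rcases eq_or_ne s i with rfl | hs
    · rw [Function.update_self]
      exact div_pos (by linarith) hc
    · rw [Function.update_of_ne hs]
      exact one_pos
  · refine pos_of_mul_pos_right ?_ hc.le
    rw [adjForm_complete_square, Function.update_self, Function.update_of_ne hij.symm,
      Function.update_of_ne hki, hwc]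
    simp only [Pi.one_apply]
    nlinarith

lemma StructCondE.exists_adjForm_pos (h : StructCondE ε η) :
    ∃ u : Fin 3 → ℝ, (∀ s, 0 < u s) ∧ 0 < adjForm ε η 0 1 2 u u := by
  by_cases h0 : ε 1 * ε 2 - η 1 2 ^ 2 < 0
  · exact h.exists_adjForm_pos_of_neg (by decide) (by decide) (by decide) h0
  by_cases h1 : ε 2 * ε 0 - η 2 0 ^ 2 < 0
  · simp_rw [adjForm_rotate ε η 0 1 2]
    exact h.exists_adjForm_pos_of_neg (by decide) (by decide) (by decide) h1
  by_cases h2 : ε 0 * ε 1 - η 0 1 ^ 2 < 0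
  · simp_rw [adjForm_rotate ε η 0 1 2, adjForm_rotate ε η 1 2 0]
    exact h.exists_adjForm_pos_of_neg (by decide) (by decide) (by decide) h2
  have g0 := h.cross_nonneg (q := 0) (s := 1) (t := 2) (by decide) (by decide) (by decide)
  have g1 := h.cross_nonneg (q := 1) (s := 2) (t := 0) (by decide) (by decide) (by decide)
  have g2 := h.cross_nonneg (q := 2) (s := 0) (t := 1) (by decide) (by decide) (by decide)
  push Not at h0 h1 h2
  refine ⟨fun _ => 1, fun _ => one_pos, ?_⟩
  have weight_eq_one {s t : Fin 3} (hst : s ≠ t) (hc : 0 ≤ ε s * ε t - η s t ^ 2) :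
      ε s = 1 ∧ -1 < η s t := by
    rcases h.eta_pos_or hst with hp | ⟨hs, -, h1⟩
    · refine ⟨(h.1 s).resolve_left fun hs => ?_, by linarith⟩
      rw [hs] at hc
      nlinarith
    · exact ⟨hs, h1⟩
  obtain ⟨e1, b1⟩ := weight_eq_one (by decide) h0
  obtain ⟨e2, b2⟩ := weight_eq_one (by decide) h1
  obtain ⟨e0, b0⟩ := weight_eq_one (by decide) h2
  simp only [adjForm, e0, e1, e2] at g0 g1 g2 h0 h1 h2 ⊢
  by_cases hz : 0 < 1 * 1 - η 1 2 ^ 2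
  · linarith
  have hη : η 1 2 = 1 := by nlinarith
  rw [hη] at g0 g1 g2 ⊢
  linarith [mul_pos (neg_lt_iff_pos_add.1 b2) (neg_lt_iff_pos_add.1 b0)]

/-- The positive vectors on which the adjugate form is positive. -/
def adjCone (ε : Fin 3 → ℝ) (η : Fin 3 → Fin 3 → ℝ) : Set (Fin 3 → ℝ) :=
  {u | (∀ s, 0 < u s) ∧ 0 < adjForm ε η 0 1 2 u u}

lemma StructCondE.convex_adjCone (h : StructCondE ε η) : Convex ℝ (adjCone ε η) := by
  rw [convex_iff_forall_pos]
  rintro u ⟨hu, hqu⟩ v ⟨hv, hqv⟩ a b ha hb -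
  refine ⟨fun s => ?_, ?_⟩
  · have := hu s
    have := hv s
    simp only [Pi.add_apply, Pi.smul_apply, smul_eq_mul]
    positivity
  · have := h.adjForm_nonneg hu hv hqu hqv
    rw [adjForm_combo]
    positivity

lemma lE_comm (h : StructCondE ε η) (f : Fin 3 → ℝ) (s t : Fin 3) :
    lE ε η f s t = lE ε η f t s := by
  unfold lE
  rw [h.2.1 s t, add_comm (f s), add_comm (ε s * _)]

lemma lE_arg_pos (h : StructCondE ε η) (f : Fin 3 → ℝ) {s t : Fin 3} (hst : s ≠ t) :
    0 < ε s * exp (2 * f s) + ε t * exp (2 * f t) + 2 * η s t * exp (f s + f t) := by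
  have := h.edge_pos hst (exp_pos (f s)) (exp_pos (f t))
  rwa [← exp_add, ← exp_nat_mul, ← exp_nat_mul] at this

lemma lE_pos (h : StructCondE ε η) (f : Fin 3 → ℝ) {s t : Fin 3} (hst : s ≠ t) :
    0 < lE ε η f s t :=
  Real.sqrt_pos.2 (lE_arg_pos h f hst)

lemma lE_sq (h : StructCondE ε η) (f : Fin 3 → ℝ) {s t : Fin 3} (hst : s ≠ t) :
    lE ε η f s t ^ 2 =
      ε s * exp (f s) ^ 2 + ε t * exp (f t) ^ 2 + 2 * η s t * (exp (f s) * exp (f t)) := by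
  rw [lE, Real.sq_sqrt (lE_arg_pos h f hst).le, ← exp_add, ← exp_nat_mul, ← exp_nat_mul]
  norm_num

/-- Heron's formula detects the triangle inequalities. -/
lemma triangle_iff_heron_pos {a b c : ℝ} (ha : 0 < a) (hb : 0 < b) (hc : 0 < c) :
    (a < b + c ∧ b < c + a ∧ c < a + b) ↔
      0 < (a ^ 2 + b ^ 2 + c ^ 2) ^ 2 - 2 * ((a ^ 2) ^ 2 + (b ^ 2) ^ 2 + (c ^ 2) ^ 2) := by
  have e : (a ^ 2 + b ^ 2 + c ^ 2) ^ 2 - 2 * ((a ^ 2) ^ 2 + (b ^ 2) ^ 2 + (c ^ 2) ^ 2) =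
      (a + b + c) * ((b + c - a) * ((c + a - b) * (a + b - c))) := by ring
  rw [e, mul_pos_iff_of_pos_left (by positivity)]
  refine ⟨fun ⟨h1, h2, h3⟩ => ?_, fun h => ⟨?_, ?_, ?_⟩⟩
  · exact mul_pos (by linarith) (mul_pos (by linarith) (by linarith))
  all_goals by_contra hcon
  · have := mul_pos (by linarith : 0 < c + a - b) (by linarith : 0 < a + b - c)
    nlinarith
  · have := mul_pos (by linarith : 0 < b + c - a) (by linarith : 0 < a + b - c)
    nlinarith
  · have := mul_pos (by linarith : 0 < b + c - a) (by linarith : 0 < c + a - b)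
    nlinarith

lemma mem_OmegaE_iff (h : StructCondE ε η) (f : Fin 3 → ℝ) :
    f ∈ OmegaE ε η ↔ 0 < adjForm ε η 0 1 2 (fun s => exp (-f s)) (fun s => exp (-f s)) := by
  have h12 : (1 : Fin 3) ≠ 2 := by decide
  have h20 : (2 : Fin 3) ≠ 0 := by decide
  have h01 : (0 : Fin 3) ≠ 1 := by decide
  have c21 := lE_comm h f 2 1
  have c02 := lE_comm h f 0 2
  have c10 := lE_comm h f 1 0
  have triangle : f ∈ OmegaE ε η ↔ lE ε η f 1 2 < lE ε η f 2 0 + lE ε η f 0 1 ∧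
      lE ε η f 2 0 < lE ε η f 0 1 + lE ε η f 1 2 ∧
      lE ε η f 0 1 < lE ε η f 1 2 + lE ε η f 2 0 := by
    constructor
    · intro hf
      have t0 := hf 0 1 2 (by decide) (by decide) (by decide)
      have t1 := hf 1 2 0 (by decide) (by decide) (by decide)
      have t2 := hf 2 0 1 (by decide) (by decide) (by decide)
      refine ⟨?_, ?_, ?_⟩ <;> linarith
    · rintro ⟨t0, t1, t2⟩ s t r hst hsr htr
      fin_cases s <;> fin_cases t <;> fin_cases r <;> simp at hst hsr htr ⊢ <;> linarith
  rw [triangle, triangle_iff_heron_pos (lE_pos h f h12) (lE_pos h f h20) (lE_pos h f h01),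
    lE_sq h f h12, lE_sq h f h20, lE_sq h f h01]
  have p0 := exp_pos (f 0)
  have p1 := exp_pos (f 1)
  have p2 := exp_pos (f 2)
  rw [← mul_pos_iff_of_pos_left (a := 4 * (exp (f 0) * exp (f 1) * exp (f 2)) ^ 2)
    (b := adjForm _ _ _ _ _ _ _) (by positivity)]
  refine iff_of_eq (congrArg _ ?_)
  simp only [adjForm, exp_neg]
  field_simp
  ring

/-- In the coordinates `exp (-f s)` the admissible space becomes a convex cone. -/
noncomputable def omegaHomeomorph (h : StructCondE ε η) : OmegaE ε η ≃ₜ adjCone ε η where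
  toFun f := ⟨fun s => exp (-f.1 s), fun _ => exp_pos _, (mem_OmegaE_iff h f.1).1 f.2⟩
  invFun u := ⟨fun s => -log (u.1 s), by
    rw [mem_OmegaE_iff h]
    simpa only [neg_neg, exp_log (u.2.1 _)] using u.2.2⟩
  left_inv f := by ext; simp
  right_inv u := by ext s; simp [exp_log (u.2.1 s)]
  continuous_toFun := by
    refine Continuous.subtype_mk (continuous_pi fun s => continuous_exp.comp (Continuous.neg ?_)) _
    exact (continuous_apply s).comp continuous_subtype_val
  continuous_invFun := by
    refine Continuous.subtype_mk (continuous_pi fun s => Continuous.neg ?_) _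
    exact Continuous.log ((continuous_apply s).comp continuous_subtype_val) fun u => (u.2.1 s).ne'

end StructCond

/-- Under the structure conditions, the admissible space `Ω^E_{ijk}` of
Euclidean discrete conformal structures for the triangle is nonempty and, as a topological
subspace of `ℝ³`, simply connected (in Mathlib `SimplyConnectedSpace` includes
path-connectedness). -/
theorem euclidean_admissible_space_nonempty_simplyConnected
    (ε : Fin 3 → ℝ) (η : Fin 3 → Fin 3 → ℝ) (hstruct : StructCondE ε η) :
    (OmegaE ε η).Nonempty ∧ SimplyConnectedSpace (OmegaE ε η) := by
  obtain ⟨u, hu⟩ := hstruct.exists_adjForm_pos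
  have hne : (adjCone ε η).Nonempty := ⟨u, hu⟩
  have := hstruct.convex_adjCone.contractibleSpace hne
  have := (omegaHomeomorph hstruct).contractibleSpace
  exact ⟨⟨_, ((omegaHomeomorph hstruct).symm ⟨u, hu⟩).2⟩, inferInstance⟩
end

section
/- Let f : ℝᴺ → ℝ be a C¹ smooth convex function, let x₀ ∈ ℝᴺ satisfy ∇f(x₀) = 0, and suppose f is C² smooth and strictly convex (its Hessian is positive definite) on some open neighborhood of x₀. Then f(x) → +∞ as ‖x‖ → ∞. -/
open Filter Topology Set

/-- If a convex function on a real normed space is differentiable at `x`, it lies above its tangent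
hyperplane at `x`. -/
lemma ConvexOn.add_fderiv_le {E : Type*} [NormedAddCommGroup E] [NormedSpace ℝ E] {f : E → ℝ}
    (hconv : ConvexOn ℝ univ f) {x : E} (hf : DifferentiableAt ℝ f x) (v : E) :
    f x + fderiv ℝ f x v ≤ f (x + v) := by
  have hg : ConvexOn ℝ univ (fun t : ℝ => f (x + t • v)) := by
    have h := hconv.comp_affineMap (AffineMap.lineMap x (x + v) : ℝ →ᵃ[ℝ] E)
    simpa [Function.comp_def, AffineMap.lineMap_apply, add_comm] using h
  have hd : HasDerivAt (fun t : ℝ => f (x + t • v)) (fderiv ℝ f x v) 0 :=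
    hf.hasFDerivAt.hasLineDerivAt v
  have h := hg.le_slope_of_hasDerivAt (mem_univ 0) (mem_univ 1) one_pos hd
  simp only [slope_def_field, one_smul, zero_smul, add_zero, sub_zero, div_one] at h
  linarith

/-- A differentiable convex function with a critical point at which the second derivative in the
direction `v` is positive takes a strictly larger value at `x + v` than at `x`. -/
lemma ConvexOn.lt_add_of_fderiv_fderiv_pos {E : Type*} [NormedAddCommGroup E] [NormedSpace ℝ E]
    {f : E → ℝ} (hconv : ConvexOn ℝ univ f) (hf : Differentiable ℝ f) {x : E}
    (hcrit : fderiv ℝ f x = 0) {v : E} (hv : 0 < fderiv ℝ (fun y => fderiv ℝ f y v) x v) :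
    f x < f (x + v) := by
  have hdiff : DifferentiableAt ℝ (fun y => fderiv ℝ f y v) x := by
    by_contra h
    simp [fderiv_zero_of_not_differentiableAt h] at hv
  have hd : HasDerivAt (fun t : ℝ => fderiv ℝ f (x + t • v) v)
      (fderiv ℝ (fun y => fderiv ℝ f y v) x v) 0 :=
    hdiff.hasFDerivAt.hasLineDerivAt v
  have hslope := (hd.tendsto_slope.mono_left (nhdsGT_le_nhdsNE 0)).eventually_const_lt hv
  obtain ⟨t, hpos, ht0, ht1⟩ :=
    (hslope.and (Ioo_mem_nhdsGT (zero_lt_one' ℝ))).exists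
  have hderiv : 0 < fderiv ℝ f (x + t • v) v := by
    simpa [slope_def_field, hcrit, ht0] using hpos
  have h1 := hconv.add_fderiv_le (hf x) (t • v)
  have h2 := hconv.add_fderiv_le (hf (x + t • v)) ((1 - t) • v)
  have h3 : x + t • v + (1 - t) • v = x + v := by module
  rw [h3, map_smul, smul_eq_mul] at h2
  simp only [hcrit, zero_apply, add_zero] at h1
  nlinarith [mul_pos (sub_pos.2 ht1) hderiv]

/-- A continuous convex function on a proper space with a strict global minimum tends to infinity
at infinity. -/
lemma ConvexOn.tendsto_cocompact_atTop_of_forall_lt {E : Type*} [NormedAddCommGroup E]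
    [NormedSpace ℝ E] [ProperSpace E] {f : E → ℝ} (hconv : ConvexOn ℝ univ f)
    (hf : Continuous f) {x : E} (hmin : ∀ v, v ≠ 0 → f x < f (x + v)) :
    Tendsto f (cocompact E) atTop := by
  obtain ⟨c, hc, hle⟩ : ∃ c > 0, ∀ v ∈ Metric.sphere (0 : E) 1, f x + c ≤ f (x + v) := by
    rcases (Metric.sphere (0 : E) 1).eq_empty_or_nonempty with h | h
    · exact ⟨1, one_pos, by simp [h]⟩
    · obtain ⟨w, hw, hwmin⟩ := (isCompact_sphere (0 : E) 1).exists_isMinOn h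
        (f := fun v => f (x + v)) (by fun_prop)
      refine ⟨f (x + w) - f x, sub_pos.2 (hmin w (ne_zero_of_mem_unit_sphere ⟨w, hw⟩)), ?_⟩
      intro v hv
      have := hwmin hv
      simp only [mem_ofPred_eq] at this
      linarith
  have hgrow : ∀ v : E, 1 ≤ ‖v‖ → f x + c * ‖v‖ ≤ f (x + v) := by
    intro v hv
    have hpos : 0 < ‖v‖ := one_pos.trans_le hv
    have hinv : ‖v‖⁻¹ ≤ 1 := inv_le_one_of_one_le₀ hv
    have h1 := hle (‖v‖⁻¹ • v) (by simp [norm_smul, hpos.ne'])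
    have h2 := hconv.2 (mem_univ x) (mem_univ (x + v)) (sub_nonneg.2 hinv)
      (inv_nonneg.2 hpos.le) (by ring)
    have h3 : (1 - ‖v‖⁻¹) • x + ‖v‖⁻¹ • (x + v) = x + ‖v‖⁻¹ • v := by module
    rw [h3, smul_eq_mul, smul_eq_mul] at h2
    have h4 : c ≤ ‖v‖⁻¹ * (f (x + v) - f x) := by linarith
    rw [inv_mul_eq_div, le_div_iff₀ hpos] at h4
    linarith
  have hnorm : Tendsto (fun y : E => ‖y - x‖) (cocompact E) atTop :=
    (tendsto_norm_cocompact_atTop (E := E)).comp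
      (Homeomorph.subRight x).isClosedEmbedding.tendsto_cocompact
  refine tendsto_atTop_mono' _ ?_
    (tendsto_atTop_add_const_left _ (f x) (hnorm.const_mul_atTop hc))
  filter_upwards [hnorm.eventually_ge_atTop 1] with y hy
  simpa using hgrow (y - x) hy


/-- Let `f : ℝᴺ → ℝ` be a `C¹` convex function, let `x₀` be a critical
point of `f`, and suppose `f` is `C²` and strictly convex (positive definite Hessian) on an
open neighborhood of `x₀`.  Then `f x → +∞` as `‖x‖ → ∞`. -/
theorem convex_function_proper
    {N : ℕ} (f : EuclideanSpace ℝ (Fin N) → ℝ)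
    (hC1 : ContDiff ℝ 1 f)
    (hconv : ConvexOn ℝ Set.univ f)
    (x₀ : EuclideanSpace ℝ (Fin N)) (hcrit : fderiv ℝ f x₀ = 0)
    (U : Set (EuclideanSpace ℝ (Fin N))) (hU : IsOpen U) (hx₀ : x₀ ∈ U)
    (hC2 : ContDiffOn ℝ 2 f U)
    (hHess : ∀ x ∈ U, ∀ v : EuclideanSpace ℝ (Fin N), v ≠ 0 →
      0 < fderiv ℝ (fun y => fderiv ℝ f y v) x v) :
    Filter.Tendsto f (Filter.cocompact (EuclideanSpace ℝ (Fin N))) Filter.atTop := by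
  have hf : Differentiable ℝ f := hC1.differentiable one_ne_zero
  exact hconv.tendsto_cocompact_atTop_of_forall_lt hf.continuous fun v hv =>
    hconv.lt_add_of_fderiv_fderiv_pos hf hcrit (hHess x₀ hx₀ v hv)
end

section
/- Let α ∈ ℝ and R̄ : V → ℝ. Suppose u_A ∈ U^E and u_B ∈ ℝᴺ have the same extended combinatorial α-curvature R̄, i.e. R̃_{α,i}(u_A) = R̃_{α,i}(u_B) = R̄_i for all i ∈ V. If α R̄_i = 0 for all i, then u_B = u_A + c·(1,…,1) for some c ∈ ℝ (equivalently the conformal factors satisfy r_B = λ r_A for some λ > 0). If α R̄_i ≤ 0 for all i and α R̄_i < 0 for at least one i, then u_A = u_B. -/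
open Real

/-- A combinatorial triangulation of a connected closed surface on the vertex set
`Fin N`: a nonempty set of triangular faces covering all vertices, such that every
edge (2-element subset of a face) lies in exactly two faces and the underlying
graph is connected. -/
structure TriSurface (N : ℕ) where
  /-- The set of faces, each a 3-element subset of the vertex set. -/
  F : Finset (Finset (Fin N))
  F_nonempty : F.Nonempty
  card_face : ∀ σ ∈ F, σ.card = 3
  vertex_cover : ∀ v : Fin N, ∃ σ ∈ F, v ∈ σ
  edge_two_faces : ∀ e : Finset (Fin N), e.card = 2 → (∃ σ ∈ F, e ⊆ σ) →
    (F.filter fun σ => e ⊆ σ).card = 2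
  connected : (SimpleGraph.fromRel fun i j => ∃ σ ∈ F, i ∈ σ ∧ j ∈ σ).Connected

namespace TriSurface

variable {N : ℕ}

/-- The edge set: all 2-element subsets of faces. -/
def edges (S : TriSurface N) : Finset (Finset (Fin N)) :=
  S.F.biUnion fun σ => Finset.powersetCard 2 σ

/-- The Euler characteristic `χ = N - |E| + |F|`. -/
def chi (S : TriSurface N) : ℤ :=
  (N : ℤ) - (S.edges.card : ℤ) + (S.F.card : ℤ)

/-- Weights on a triangulated surface: scheme coefficients `ε : V → {0,1}` and symmetric
discrete conformal structure coefficients `η : E → ℝ`, subject to the structure conditions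
`ε_s ε_t + η_st > 0` on every edge and `ε_q η_st + η_qs η_qt ≥ 0` in every face. -/
structure Weights (S : TriSurface N) where
  eps : Fin N → ℝ
  eta : Fin N → Fin N → ℝ
  eps01 : ∀ i, eps i = 0 ∨ eps i = 1
  eta_symm : ∀ i j, eta i j = eta j i
  structCond1 : ∀ i j : Fin N, ({i, j} : Finset (Fin N)) ∈ S.edges →
    eps i * eps j + eta i j > 0
  structCond2 : ∀ i j k : Fin N, ({i, j, k} : Finset (Fin N)) ∈ S.F →
    i ≠ j → i ≠ k → j ≠ k → eps i * eta j k + eta i j * eta i k ≥ 0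

variable {S : TriSurface N}

/-! ### Euclidean background -/

/-- Euclidean edge length `l_ij = sqrt(ε_i e^{2u_i} + ε_j e^{2u_j} + 2 η_ij e^{u_i+u_j})`. -/
noncomputable def lE (W : Weights S) (u : Fin N → ℝ) (i j : Fin N) : ℝ :=
  Real.sqrt (W.eps i * exp (2 * u i) + W.eps j * exp (2 * u j) +
    2 * W.eta i j * exp (u i + u j))

/-- The admissible space `U^E`: discrete conformal factors for which every face satisfies
the strict triangle inequalities. -/
def admissibleE (W : Weights S) (u : Fin N → ℝ) : Prop :=
  ∀ i j k : Fin N, ({i, j, k} : Finset (Fin N)) ∈ S.F →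
    lE W u i j + lE W u i k > lE W u j k

/-- The inner angle `θ_i^{jk}` at `i` in the face `{i,j,k}`, by the law of cosines. -/
noncomputable def thetaE (W : Weights S) (u : Fin N → ℝ) (i j k : Fin N) : ℝ :=
  arccos ((lE W u i j ^ 2 + lE W u i k ^ 2 - lE W u j k ^ 2) /
    (2 * lE W u i j * lE W u i k))

open Classical in
/-- The extended inner angle `θ̃_i^{jk}`: equal to `θ_i^{jk}` when the three strict triangle
inequalities hold in the face, to `π` when the edge opposite to `i` dominates, and to `0`
otherwise. -/
noncomputable def thetaExE (W : Weights S) (u : Fin N → ℝ) (i j k : Fin N) : ℝ :=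
  if lE W u i j + lE W u i k > lE W u j k ∧ lE W u i j + lE W u j k > lE W u i k ∧
      lE W u i k + lE W u j k > lE W u i j then thetaE W u i j k
  else if lE W u j k ≥ lE W u i j + lE W u i k then π else 0

open Classical in
/-- The angle at `i` in a face `σ` containing `i` (the half-sum over the two orderings of
the remaining two vertices; the angle is symmetric in the last two arguments). -/
noncomputable def faceAngleE (W : Weights S) (u : Fin N → ℝ) (i : Fin N)
    (σ : Finset (Fin N)) : ℝ :=
  (1 / 2) * ∑ j ∈ σ.erase i, ∑ k ∈ (σ.erase i).erase j, thetaE W u i j k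

open Classical in
/-- The extended angle at `i` in a face `σ` containing `i`. -/
noncomputable def faceAngleExE (W : Weights S) (u : Fin N → ℝ) (i : Fin N)
    (σ : Finset (Fin N)) : ℝ :=
  (1 / 2) * ∑ j ∈ σ.erase i, ∑ k ∈ (σ.erase i).erase j, thetaExE W u i j k

open Classical in
/-- The classical combinatorial curvature `K_i = 2π − Σ θ_i^{jk}`. -/
noncomputable def KE (W : Weights S) (u : Fin N → ℝ) (i : Fin N) : ℝ :=
  2 * π - ∑ σ ∈ S.F.filter (fun σ => i ∈ σ), faceAngleE W u i σ

open Classical in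
/-- The extended combinatorial curvature `K̃_i = 2π − Σ θ̃_i^{jk}`. -/
noncomputable def KExE (W : Weights S) (u : Fin N → ℝ) (i : Fin N) : ℝ :=
  2 * π - ∑ σ ∈ S.F.filter (fun σ => i ∈ σ), faceAngleExE W u i σ

/-- The combinatorial `α`-curvature `R_{α,i} = K_i e^{−α u_i}` (Euclidean background). -/
noncomputable def RE (W : Weights S) (α : ℝ) (u : Fin N → ℝ) (i : Fin N) : ℝ :=
  KE W u i * exp (-(α * u i))

/-- The extended combinatorial `α`-curvature `R̃_{α,i} = K̃_i e^{−α u_i}` (Euclidean). -/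
noncomputable def RExE (W : Weights S) (α : ℝ) (u : Fin N → ℝ) (i : Fin N) : ℝ :=
  KExE W u i * exp (-(α * u i))

/-- The Jacobian `∂K_i/∂u_j` of the curvature map in the Euclidean background. -/
noncomputable def DKE (W : Weights S) (u : Fin N → ℝ) (i j : Fin N) : ℝ :=
  fderiv ℝ (fun v => KE W v i) u (Pi.single j 1)

/-- The discrete `α`-Laplacian `(Δ_α g)_i = −e^{−α u_i} Σ_j (∂K_i/∂u_j) g_j` (Euclidean). -/
noncomputable def LapE (W : Weights S) (α : ℝ) (u : Fin N → ℝ) (g : Fin N → ℝ)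
    (i : Fin N) : ℝ :=
  -exp (-(α * u i)) * ∑ j, DKE W u i j * g j

/-! ### Hyperbolic background -/

/-- The inverse hyperbolic cosine. -/
noncomputable def arcosh (x : ℝ) : ℝ := Real.log (x + Real.sqrt (x ^ 2 - 1))

/-- Hyperbolic edge length
`l_ij = arcosh(sqrt((1+ε_i e^{2f_i})(1+ε_j e^{2f_j})) + η_ij e^{f_i+f_j})`. -/
noncomputable def lH (W : Weights S) (f : Fin N → ℝ) (i j : Fin N) : ℝ :=
  arcosh (Real.sqrt ((1 + W.eps i * exp (2 * f i)) * (1 + W.eps j * exp (2 * f j))) +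
    W.eta i j * exp (f i + f j))

open Classical in
/-- The coordinate change `f ↦ u` at a vertex with scheme coefficient `e`. -/
noncomputable def ucoord (e x : ℝ) : ℝ :=
  if e = 0 then x
  else (1 / 2) * Real.log ((Real.sqrt (1 + exp (2 * x)) - 1) / (Real.sqrt (1 + exp (2 * x)) + 1))

/-- The discrete conformal structure `u` associated to the conformal factor `f`
(hyperbolic background). -/
noncomputable def uOf (W : Weights S) (f : Fin N → ℝ) (i : Fin N) : ℝ :=
  ucoord (W.eps i) (f i)

/-- The admissible space `U^H` (described in the `f`-coordinates): every face satisfies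
the strict triangle inequalities. -/
def admissibleH (W : Weights S) (f : Fin N → ℝ) : Prop :=
  ∀ i j k : Fin N, ({i, j, k} : Finset (Fin N)) ∈ S.F →
    lH W f i j + lH W f i k > lH W f j k

/-- The inner angle `θ_i^{jk}` at `i` in the hyperbolic face `{i,j,k}`, by the hyperbolic
law of cosines. -/
noncomputable def thetaH (W : Weights S) (f : Fin N → ℝ) (i j k : Fin N) : ℝ :=
  arccos ((Real.cosh (lH W f i j) * Real.cosh (lH W f i k) - Real.cosh (lH W f j k)) /
    (Real.sinh (lH W f i j) * Real.sinh (lH W f i k)))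

open Classical in
/-- The extended hyperbolic inner angle `θ̃_i^{jk}`. -/
noncomputable def thetaExH (W : Weights S) (f : Fin N → ℝ) (i j k : Fin N) : ℝ :=
  if lH W f i j + lH W f i k > lH W f j k ∧ lH W f i j + lH W f j k > lH W f i k ∧
      lH W f i k + lH W f j k > lH W f i j then thetaH W f i j k
  else if lH W f j k ≥ lH W f i j + lH W f i k then π else 0

open Classical in
/-- The angle at `i` in a hyperbolic face `σ` containing `i`. -/
noncomputable def faceAngleH (W : Weights S) (f : Fin N → ℝ) (i : Fin N)
    (σ : Finset (Fin N)) : ℝ :=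
  (1 / 2) * ∑ j ∈ σ.erase i, ∑ k ∈ (σ.erase i).erase j, thetaH W f i j k

open Classical in
/-- The extended angle at `i` in a hyperbolic face `σ` containing `i`. -/
noncomputable def faceAngleExH (W : Weights S) (f : Fin N → ℝ) (i : Fin N)
    (σ : Finset (Fin N)) : ℝ :=
  (1 / 2) * ∑ j ∈ σ.erase i, ∑ k ∈ (σ.erase i).erase j, thetaExH W f i j k

open Classical in
/-- The classical combinatorial curvature (hyperbolic background). -/
noncomputable def KH (W : Weights S) (f : Fin N → ℝ) (i : Fin N) : ℝ :=
  2 * π - ∑ σ ∈ S.F.filter (fun σ => i ∈ σ), faceAngleH W f i σ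

open Classical in
/-- The extended combinatorial curvature (hyperbolic background). -/
noncomputable def KExH (W : Weights S) (f : Fin N → ℝ) (i : Fin N) : ℝ :=
  2 * π - ∑ σ ∈ S.F.filter (fun σ => i ∈ σ), faceAngleExH W f i σ

/-- The combinatorial `α`-curvature `R_{α,i} = K_i e^{−α u_i}` (hyperbolic background),
expressed as a function of the conformal factor `f`. -/
noncomputable def RH (W : Weights S) (α : ℝ) (f : Fin N → ℝ) (i : Fin N) : ℝ :=
  KH W f i * exp (-(α * uOf W f i))

/-- The extended combinatorial `α`-curvature `R̃_{α,i} = K̃_i e^{−α u_i}` (hyperbolic). -/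
noncomputable def RExH (W : Weights S) (α : ℝ) (f : Fin N → ℝ) (i : Fin N) : ℝ :=
  KExH W f i * exp (-(α * uOf W f i))

/-- The Jacobian `∂K_i/∂u_j` in the hyperbolic background, computed by the chain rule from
the `f`-coordinates: `(∂K_i/∂f_j) / (du_j/df_j)`. -/
noncomputable def DKH (W : Weights S) (f : Fin N → ℝ) (i j : Fin N) : ℝ :=
  fderiv ℝ (fun g => KH W g i) f (Pi.single j 1) / deriv (ucoord (W.eps j)) (f j)

/-- The discrete `α`-Laplacian `(Δ_α g)_i = −e^{−α u_i} Σ_j (∂K_i/∂u_j) g_j` (hyperbolic). -/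
noncomputable def LapH (W : Weights S) (α : ℝ) (f : Fin N → ℝ) (g : Fin N → ℝ)
    (i : Fin N) : ℝ :=
  -exp (-(α * uOf W f i)) * ∑ j, DKH W f i j * g j

/-- The Euclidean norm on `Fin N → ℝ`. -/
noncomputable def enorm (v : Fin N → ℝ) : ℝ := Real.sqrt (∑ i, v i ^ 2)

end TriSurface

open TriSurface

/-- A continuous function which has nonpositive derivative on an open set and takes only finitely
many values outside of it is antitone. -/
theorem antitone_of_hasDerivAt_nonpos_of_finite_image_compl {g g' : ℝ → ℝ} {O F : Set ℝ}
    (hg : Continuous g) (hO : IsOpen O) (hF : F.Finite)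
    (hd : ∀ t ∈ O, HasDerivAt g (g' t) t) (hn : ∀ t ∈ O, g' t ≤ 0)
    (hc : ∀ t ∉ O, g t ∈ F) : Antitone g := by
  intro a b hab
  by_contra! hlt
  obtain ⟨y, ⟨hy1, hy2⟩, hyF⟩ := ((Set.Ioo_infinite hlt).sdiff hF).nonempty
  have hcomp : IsCompact (Set.Icc a b ∩ {t | g t ≤ y}) :=
    isCompact_Icc.inter_right (isClosed_le hg continuous_const)
  obtain ⟨t₀, ⟨⟨ha, hb⟩, hle⟩, hmax⟩ := hcomp.exists_isGreatest ⟨a, ⟨le_rfl, hab⟩, hy1.le⟩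
  simp only [Set.mem_ofPred_eq] at hle
  have hb' : t₀ < b := lt_of_le_of_ne hb (by rintro rfl; linarith)
  obtain ⟨s, ⟨hs1, hs2⟩, hs⟩ :=
    intermediate_value_Icc hb hg.continuousOn ⟨hle, hy2.le⟩
  have hst : s ≤ t₀ := hmax ⟨⟨ha.trans hs1, hs2⟩, hs.le⟩
  obtain rfl : s = t₀ := le_antisymm hst hs1
  have hsO : s ∈ O := by
    by_contra h
    exact hyF (hs ▸ hc s h)
  obtain ⟨δ, hδ, hball⟩ := Metric.isOpen_iff.1 hO s hsO
  set r := min (s + δ / 2) b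
  have hsr : s < r := lt_min (by linarith) hb'
  have hsub : Set.Icc s r ⊆ O := fun t ht => hball (by
    have : t ≤ s + δ / 2 := ht.2.trans (min_le_left _ _)
    rw [Metric.mem_ball, Real.dist_eq, abs_of_nonneg (by linarith [ht.1])]
    linarith)
  have hanti : AntitoneOn g (Set.Icc s r) :=
    antitoneOn_of_deriv_nonpos (convex_Icc s r) hg.continuousOn
      (fun t ht => (hd t (hsub (interior_subset ht))).differentiableAt.differentiableWithinAt)
      (fun t ht => by
        rw [(hd t (hsub (interior_subset ht))).deriv]
        exact hn t (hsub (interior_subset ht)))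
  have h1 : g r ≤ g s := hanti ⟨le_rfl, hsr.le⟩ ⟨hsr.le, le_rfl⟩ hsr.le
  have h2 : r ≤ s := hmax ⟨⟨ha.trans hsr.le, min_le_right _ _⟩, h1.trans hs.le⟩
  linarith

/-- The angle opposite to the side `r` in a triangle with sides `p`, `q`, `r`. -/
noncomputable def triAngle (p q r : ℝ) : ℝ := arccos ((p ^ 2 + q ^ 2 - r ^ 2) / (2 * p * q))

theorem triAngle_comm (p q r : ℝ) : triAngle p q r = triAngle q p r := by
  unfold triAngle
  congr 1
  ring

theorem triAngle_eq_pi {p q r : ℝ} (hp : 0 < p) (hq : 0 < q) (h : p + q ≤ r) :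
    triAngle p q r = π := by
  rw [triAngle, arccos_eq_pi, div_le_iff₀ (by positivity)]
  nlinarith

theorem triAngle_eq_zero {p q r : ℝ} (hp : 0 < p) (hq : 0 < q) (hr : 0 < r) (h : q + r ≤ p) :
    triAngle p q r = 0 := by
  rw [triAngle, arccos_eq_zero, le_div_iff₀ (by positivity)]
  nlinarith

theorem triAngle_mem_of_degenerate {p q r : ℝ} (hp : 0 < p) (hq : 0 < q) (hr : 0 < r)
    (h : ¬ (r < p + q ∧ q < p + r ∧ p < q + r)) : triAngle p q r ∈ ({0, π} : Set ℝ) := by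
  by_cases h1 : p + q ≤ r
  · exact Or.inr (triAngle_eq_pi hp hq h1)
  · left
    by_cases h2 : q + r ≤ p
    · exact triAngle_eq_zero hp hq hr h2
    · rw [triAngle_comm]
      refine triAngle_eq_zero hq hp hr ?_
      by_contra h3
      exact h ⟨not_le.1 h1, not_le.1 h3, not_le.1 h2⟩

/-- Four times the squared area of the triangle with sides `p`, `q`, `r`. -/
noncomputable def heron (p q r : ℝ) : ℝ := p ^ 2 * q ^ 2 - ((p ^ 2 + q ^ 2 - r ^ 2) / 2) ^ 2

theorem heron_pos {p q r : ℝ} (hp : 0 < p) (h1 : r < p + q) (h2 : q < p + r) (h3 : p < q + r) :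
    0 < heron p q r := by
  have : heron p q r = (p + q + r) * (p + q - r) * (p + r - q) * (q + r - p) / 4 := by
    unfold heron; ring
  rw [this]
  have a1 := sub_pos.2 h1
  have a2 := sub_pos.2 h2
  have a3 := sub_pos.2 h3
  have a4 : 0 < p + q + r := by linarith
  positivity

/-- Variation of an angle in terms of the logarithmic derivatives of the side lengths. -/
theorem hasDerivAt_triAngle {p q r : ℝ → ℝ} {t a b c : ℝ}
    (hp : 0 < p t) (hq : 0 < q t) (hh : 0 < heron (p t) (q t) (r t))
    (dp : HasDerivAt p (p t * a) t) (dq : HasDerivAt q (q t * b) t)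
    (dr : HasDerivAt r (r t * c) t) :
    HasDerivAt (fun s => triAngle (p s) (q s) (r s))
      (((p t ^ 2 + r t ^ 2 - q t ^ 2) / 2 * (c - a) + (q t ^ 2 + r t ^ 2 - p t ^ 2) / 2 * (c - b)) /
        √(heron (p t) (q t) (r t))) t := by
  have key : 1 - ((p t ^ 2 + q t ^ 2 - r t ^ 2) / (2 * p t * q t)) ^ 2 =
      heron (p t) (q t) (r t) / (p t * q t) ^ 2 := by
    unfold heron
    field_simp
  have hpos : 0 < 1 - ((p t ^ 2 + q t ^ 2 - r t ^ 2) / (2 * p t * q t)) ^ 2 := by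
    rw [key]; positivity
  have hsq : √(1 - ((p t ^ 2 + q t ^ 2 - r t ^ 2) / (2 * p t * q t)) ^ 2) =
      √(heron (p t) (q t) (r t)) / (p t * q t) := by
    rw [key, Real.sqrt_div hh.le, Real.sqrt_sq (by positivity)]
  have df := ((((dp.pow 2).add (dq.pow 2)).sub (dr.pow 2)).div ((dp.const_mul 2).mul dq)
    (mul_pos (mul_pos two_pos hp) hq).ne')
  have hA := hasDerivAt_arccos (x := (p t ^ 2 + q t ^ 2 - r t ^ 2) / (2 * p t * q t))
    (by intro h; rw [h] at hpos; norm_num at hpos) (by intro h; rw [h] at hpos; norm_num at hpos)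
  have := hA.comp t df
  refine this.congr_deriv ?_
  rw [hsq]
  have hs : 0 < √(heron (p t) (q t) (r t)) := Real.sqrt_pos.2 hh
  simp
  field_simp
  ring

/-- The edge length attached to two vertices with scheme coefficients `e₁`, `e₂`, edge weight `c`
and conformal factors `u₁`, `u₂`. -/
noncomputable def edgeLen (e₁ e₂ c u₁ u₂ : ℝ) : ℝ :=
  √(e₁ * exp (2 * u₁) + e₂ * exp (2 * u₂) + 2 * c * exp (u₁ + u₂))

theorem edgeLen_comm (e₁ e₂ c u₁ u₂ : ℝ) : edgeLen e₁ e₂ c u₁ u₂ = edgeLen e₂ e₁ c u₂ u₁ := by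
  unfold edgeLen
  congr 1
  rw [add_comm u₁ u₂]
  ring

theorem edgeForm_pos {e₁ e₂ c x y : ℝ} (h₁ : e₁ = 0 ∨ e₁ = 1) (h₂ : e₂ = 0 ∨ e₂ = 1)
    (h : 0 < e₁ * e₂ + c) (hx : 0 < x) (hy : 0 < y) :
    0 < e₁ * x ^ 2 + e₂ * y ^ 2 + 2 * c * (x * y) := by
  have hxy : 0 < x * y := mul_pos hx hy
  have hm := mul_pos h hxy
  rcases h₁ with rfl | rfl <;> rcases h₂ with rfl | rfl <;>
    nlinarith [sq_nonneg (x - y), sq_pos_of_pos hx, sq_pos_of_pos hy]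

theorem exp_form_eq (e₁ e₂ c u₁ u₂ : ℝ) :
    e₁ * exp (2 * u₁) + e₂ * exp (2 * u₂) + 2 * c * exp (u₁ + u₂) =
      e₁ * exp u₁ ^ 2 + e₂ * exp u₂ ^ 2 + 2 * c * (exp u₁ * exp u₂) := by
  rw [exp_add, ← Real.exp_nat_mul, ← Real.exp_nat_mul]
  norm_num

theorem edgeLen_pos {e₁ e₂ c : ℝ} (h₁ : e₁ = 0 ∨ e₁ = 1) (h₂ : e₂ = 0 ∨ e₂ = 1)
    (h : 0 < e₁ * e₂ + c) (u₁ u₂ : ℝ) : 0 < edgeLen e₁ e₂ c u₁ u₂ := by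
  rw [edgeLen, exp_form_eq]
  exact Real.sqrt_pos.2 (edgeForm_pos h₁ h₂ h (exp_pos _) (exp_pos _))

theorem edgeLen_sq {e₁ e₂ c : ℝ} (h₁ : e₁ = 0 ∨ e₁ = 1) (h₂ : e₂ = 0 ∨ e₂ = 1)
    (h : 0 < e₁ * e₂ + c) (u₁ u₂ : ℝ) : edgeLen e₁ e₂ c u₁ u₂ ^ 2 =
      e₁ * exp u₁ ^ 2 + e₂ * exp u₂ ^ 2 + 2 * c * (exp u₁ * exp u₂) := by
  rw [edgeLen, exp_form_eq]
  exact Real.sq_sqrt (edgeForm_pos h₁ h₂ h (exp_pos _) (exp_pos _)).le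

/-- The logarithmic derivative of the edge length in the direction `(d₁, d₂)`, in terms of
`x = exp u₁` and `y = exp u₂`. -/
noncomputable def edgeLogDeriv (e₁ e₂ c x y d₁ d₂ : ℝ) : ℝ :=
  ((e₁ * x ^ 2 + c * (x * y)) * d₁ + (e₂ * y ^ 2 + c * (x * y)) * d₂) /
    (e₁ * x ^ 2 + e₂ * y ^ 2 + 2 * c * (x * y))

theorem edgeLogDeriv_comm (e₁ e₂ c x y d₁ d₂ : ℝ) :
    edgeLogDeriv e₁ e₂ c x y d₁ d₂ = edgeLogDeriv e₂ e₁ c y x d₂ d₁ := by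
  unfold edgeLogDeriv
  congr 1 <;> ring

theorem hasDerivAt_edgeLen {e₁ e₂ c : ℝ} (h₁ : e₁ = 0 ∨ e₁ = 1) (h₂ : e₂ = 0 ∨ e₂ = 1)
    (h : 0 < e₁ * e₂ + c) (v₁ v₂ d₁ d₂ t : ℝ) :
    HasDerivAt (fun s => edgeLen e₁ e₂ c (v₁ + s * d₁) (v₂ + s * d₂))
      (edgeLen e₁ e₂ c (v₁ + t * d₁) (v₂ + t * d₂) *
        edgeLogDeriv e₁ e₂ c (exp (v₁ + t * d₁)) (exp (v₂ + t * d₂)) d₁ d₂) t := by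
  have hl (v d : ℝ) : HasDerivAt (fun s : ℝ => exp (v + s * d)) (exp (v + t * d) * d) t := by
    simpa using ((((hasDerivAt_id t).mul_const d).const_add v).exp)
  have hpos := edgeForm_pos h₁ h₂ h (exp_pos (v₁ + t * d₁)) (exp_pos (v₂ + t * d₂))
  have H := (((((hl v₁ d₁).pow 2).const_mul e₁).add (((hl v₂ d₂).pow 2).const_mul e₂)).add
    (((hl v₁ d₁).mul (hl v₂ d₂)).const_mul (2 * c))).sqrt hpos.ne'
  simp only [edgeLen, exp_form_eq]
  refine H.congr_deriv ?_
  have hs := Real.sqrt_pos.2 hpos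
  have hsq := Real.sq_sqrt hpos.le
  unfold edgeLogDeriv
  simp only [Pi.add_apply, Pi.mul_apply, Pi.pow_apply]
  rw [div_eq_iff (by positivity)]
  rw [show ∀ A B C : ℝ, A * (B / C) * (2 * A) = 2 * A ^ 2 * B / C from fun A B C => by ring, hsq,
    eq_div_iff hpos.ne']
  ring

/-- A weighted triangle Laplacian is nonnegative, and degenerate only on constants, as soon as
the relevant minors are positive. -/
theorem triangle_form_nonneg {w₁ w₂ w₃ : ℝ} (hw : 0 < w₁ * w₂ + w₁ * w₃ + w₂ * w₃)
    (hs : 0 < w₁ + w₃) (d₁ d₂ d₃ : ℝ) :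
    0 ≤ w₃ * (d₁ - d₂) ^ 2 + w₂ * (d₁ - d₃) ^ 2 + w₁ * (d₂ - d₃) ^ 2 ∧
      (w₃ * (d₁ - d₂) ^ 2 + w₂ * (d₁ - d₃) ^ 2 + w₁ * (d₂ - d₃) ^ 2 = 0 →
        d₁ = d₂ ∧ d₁ = d₃) := by
  have key : (w₁ + w₃) * (w₃ * (d₁ - d₂) ^ 2 + w₂ * (d₁ - d₃) ^ 2 + w₁ * (d₂ - d₃) ^ 2) =
      ((w₁ + w₃) * (d₁ - d₂) - w₁ * (d₁ - d₃)) ^ 2 +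
        (w₁ * w₂ + w₁ * w₃ + w₂ * w₃) * (d₁ - d₃) ^ 2 := by ring
  constructor
  · refine nonneg_of_mul_nonneg_right (a := w₁ + w₃) ?_ hs
    rw [key]
    positivity
  · intro h
    rw [h, mul_zero] at key
    have h1 : (w₁ * w₂ + w₁ * w₃ + w₂ * w₃) * (d₁ - d₃) ^ 2 = 0 := by
      nlinarith [sq_nonneg ((w₁ + w₃) * (d₁ - d₂) - w₁ * (d₁ - d₃)),
        mul_nonneg hw.le (sq_nonneg (d₁ - d₃))]
    have h2 : d₁ - d₃ = 0 := by simpa [hw.ne'] using h1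
    rw [h2] at key
    have h3 : (w₁ + w₃) * (d₁ - d₂) = 0 := by
      have : ((w₁ + w₃) * (d₁ - d₂)) ^ 2 = 0 := by linarith
      simpa only [pow_eq_zero_iff two_ne_zero] using this
    have h4 : d₁ - d₂ = 0 := (mul_eq_zero.1 h3).resolve_left hs.ne'
    exact ⟨by linarith, by linarith⟩

/-- Up to a positive factor, the signed distance from the power center of a triangle to the edge
joining the vertices with radii `x` and `y`, times the length of that edge. -/
noncomputable def centerCoord (e₁ e₂ a b c x y z : ℝ) : ℝ :=
  x * y * (x * y * (e₁ * e₂ - c ^ 2) + z * (y * (e₂ * b + a * c) + x * (e₁ * a + b * c)))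

/-- The variation of the angles paired with the direction is a weighted triangle Laplacian. -/
theorem angle_variation_eq {e₁ e₂ e₃ a b c x y z : ℝ} (d₁ d₂ d₃ : ℝ) {p q r : ℝ}
    (hp : p = e₁ * x ^ 2 + e₂ * y ^ 2 + 2 * c * (x * y))
    (hq : q = e₁ * x ^ 2 + e₃ * z ^ 2 + 2 * b * (x * z))
    (hr : r = e₂ * y ^ 2 + e₃ * z ^ 2 + 2 * a * (y * z))
    (hp0 : 0 < p) (hq0 : 0 < q) (hr0 : 0 < r) {f g h : ℝ}
    (hf : f = edgeLogDeriv e₁ e₂ c x y d₁ d₂) (hg : g = edgeLogDeriv e₁ e₃ b x z d₁ d₃)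
    (hh : h = edgeLogDeriv e₂ e₃ a y z d₂ d₃) :
    d₁ * ((p + r - q) / 2 * (h - f) + (q + r - p) / 2 * (h - g)) +
      d₂ * ((p + q - r) / 2 * (g - f) + (r + q - p) / 2 * (g - h)) +
      d₃ * ((q + p - r) / 2 * (f - g) + (r + p - q) / 2 * (f - h)) =
    -(centerCoord e₁ e₂ a b c x y z / p * (d₁ - d₂) ^ 2 +
      centerCoord e₁ e₃ a c b x z y / q * (d₁ - d₃) ^ 2 +
      centerCoord e₂ e₃ b c a y z x / r * (d₂ - d₃) ^ 2) := by
  unfold edgeLogDeriv at hf hg hh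
  rw [← hp] at hf
  rw [← hq] at hg
  rw [← hr] at hh
  rw [hf, hg, hh]
  field_simp
  unfold centerCoord
  rw [hp, hq, hr]
  ring

theorem centerCoord_sum_eq (e₁ e₂ e₃ a b c x y z : ℝ) :
    centerCoord e₁ e₂ a b c x y z + centerCoord e₁ e₃ a c b x z y +
      centerCoord e₂ e₃ b c a y z x =
    (e₁ * x ^ 2 + e₂ * y ^ 2 + 2 * c * (x * y)) * (e₁ * x ^ 2 + e₃ * z ^ 2 + 2 * b * (x * z)) -
      (((e₁ * x ^ 2 + e₂ * y ^ 2 + 2 * c * (x * y)) + (e₁ * x ^ 2 + e₃ * z ^ 2 + 2 * b * (x * z)) -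
        (e₂ * y ^ 2 + e₃ * z ^ 2 + 2 * a * (y * z))) / 2) ^ 2 := by
  unfold centerCoord
  ring

/-- The (scaled) power of the power center with respect to the circumcircle. -/
theorem centerCoord_minor_eq (e₁ e₂ e₃ a b c x y z : ℝ) :
    centerCoord e₂ e₃ b c a y z x * centerCoord e₁ e₃ a c b x z y *
        (e₁ * x ^ 2 + e₂ * y ^ 2 + 2 * c * (x * y)) +
      centerCoord e₂ e₃ b c a y z x * centerCoord e₁ e₂ a b c x y z *
        (e₁ * x ^ 2 + e₃ * z ^ 2 + 2 * b * (x * z)) +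
      centerCoord e₁ e₃ a c b x z y * centerCoord e₁ e₂ a b c x y z *
        (e₂ * y ^ 2 + e₃ * z ^ 2 + 2 * a * (y * z)) =
    (centerCoord e₁ e₂ a b c x y z + centerCoord e₁ e₃ a c b x z y +
      centerCoord e₂ e₃ b c a y z x) *
    (x * y * z * (2 * (e₁ * e₂ * e₃ + a * b * c) * (x * y * z) +
      (e₃ * c + a * b) * z * (e₁ * x ^ 2 + e₂ * y ^ 2) +
      (e₂ * b + a * c) * y * (e₁ * x ^ 2 + e₃ * z ^ 2) +
      (e₁ * a + b * c) * x * (e₂ * y ^ 2 + e₃ * z ^ 2))) := by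
  unfold centerCoord
  ring

theorem minor_factor_pos {e₁ e₂ e₃ a b c x y z : ℝ} (hx : 0 < x) (hy : 0 < y) (hz : 0 < z)
    (h₁ : e₁ = 0 ∨ e₁ = 1) (h₂ : e₂ = 0 ∨ e₂ = 1) (h₃ : e₃ = 0 ∨ e₃ = 1)
    (hc : 0 < e₁ * e₂ + c) (hb : 0 < e₁ * e₃ + b) (ha : 0 < e₂ * e₃ + a)
    (g₁ : 0 ≤ e₁ * a + b * c) (g₂ : 0 ≤ e₂ * b + a * c) (g₃ : 0 ≤ e₃ * c + a * b) :
    0 < 2 * (e₁ * e₂ * e₃ + a * b * c) * (x * y * z) +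
      (e₃ * c + a * b) * z * (e₁ * x ^ 2 + e₂ * y ^ 2) +
      (e₂ * b + a * c) * y * (e₁ * x ^ 2 + e₃ * z ^ 2) +
      (e₁ * a + b * c) * x * (e₂ * y ^ 2 + e₃ * z ^ 2) := by
  have amgm {e f x y : ℝ} (he : e = 0 ∨ e = 1) (hf : f = 0 ∨ f = 1) :
      2 * (e * f) * (x * y) ≤ e * x ^ 2 + f * y ^ 2 := by
    rcases he with rfl | rfl <;> rcases hf with rfl | rfl <;>
      nlinarith [sq_nonneg (x - y), sq_nonneg x, sq_nonneg y]
  have b₃ := mul_le_mul_of_nonneg_left (amgm (x := x) (y := y) h₁ h₂) (mul_nonneg g₃ hz.le)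
  have b₂ := mul_le_mul_of_nonneg_left (amgm (x := x) (y := z) h₁ h₃) (mul_nonneg g₂ hy.le)
  have b₁ := mul_le_mul_of_nonneg_left (amgm (x := y) (y := z) h₂ h₃) (mul_nonneg g₁ hx.le)
  have hN : 0 < e₁ * e₂ * e₃ + a * b * c + (e₃ * c + a * b) * (e₁ * e₂) +
      (e₂ * b + a * c) * (e₁ * e₃) + (e₁ * a + b * c) * (e₂ * e₃) := by
    have h := mul_pos (mul_pos ha hb) hc
    rcases h₁ with rfl | rfl <;> rcases h₂ with rfl | rfl <;> rcases h₃ with rfl | rfl <;>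
      linarith
  have := mul_pos hN (mul_pos (mul_pos hx hy) hz)
  linarith

/-- Positivity of the two leading minors of the angle Laplacian of a nondegenerate triangle. -/
theorem laplacian_minors_pos {h₁ h₂ h₃ p q r : ℝ} (hp : 0 < p) (hq : 0 < q) (hr : 0 < r)
    (hsum : 0 < h₁ + h₂ + h₃) (hE : 0 < h₁ * h₂ * p + h₁ * h₃ * q + h₂ * h₃ * r)
    (hΔ : 0 < p * q - ((p + q - r) / 2) ^ 2) :
    0 < h₁ / r * (h₂ / q) + h₁ / r * (h₃ / p) + h₂ / q * (h₃ / p) ∧ 0 < h₁ / r + h₃ / p := by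
  constructor
  · have : h₁ / r * (h₂ / q) + h₁ / r * (h₃ / p) + h₂ / q * (h₃ / p) =
        (h₁ * h₂ * p + h₁ * h₃ * q + h₂ * h₃ * r) / (p * q * r) := by
      field_simp
    rw [this]
    positivity
  · have e : h₁ / r + h₃ / p = (h₁ * p + h₃ * r) / (p * r) := by field_simp
    have hb : 0 ≤ h₁ ^ 2 * p + h₃ ^ 2 * r + h₁ * h₃ * (p + r - q) := by
      refine nonneg_of_mul_nonneg_right (a := p) ?_ hp
      nlinarith [sq_nonneg (p * h₁ + (p + r - q) / 2 * h₃), mul_nonneg hΔ.le (sq_nonneg h₃)]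
    have h : 0 < h₁ * p + h₃ * r := by
      refine pos_of_mul_pos_right (a := h₁ + h₂ + h₃) ?_ hsum.le
      nlinarith
    rw [e]
    positivity

/-- The sum of the angles of a face, weighted by `d`. -/
noncomputable def angleSum (d₁ d₂ d₃ p q r : ℝ) : ℝ :=
  d₁ * triAngle p q r + d₂ * triAngle p r q + d₃ * triAngle q r p

/-- Monotonicity of the extended angles of a single face, with rigidity at a nondegenerate one. -/
theorem face_angle_monotone {e₁ e₂ e₃ a b c : ℝ}
    (h₁ : e₁ = 0 ∨ e₁ = 1) (h₂ : e₂ = 0 ∨ e₂ = 1) (h₃ : e₃ = 0 ∨ e₃ = 1)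
    (hc : 0 < e₁ * e₂ + c) (hb : 0 < e₁ * e₃ + b) (ha : 0 < e₂ * e₃ + a)
    (g₁ : 0 ≤ e₁ * a + b * c) (g₂ : 0 ≤ e₂ * b + a * c) (g₃ : 0 ≤ e₃ * c + a * b)
    (v₁ v₂ v₃ d₁ d₂ d₃ : ℝ) {p q r : ℝ → ℝ}
    (hp : p = fun t => edgeLen e₁ e₂ c (v₁ + t * d₁) (v₂ + t * d₂))
    (hq : q = fun t => edgeLen e₁ e₃ b (v₁ + t * d₁) (v₃ + t * d₃))
    (hr : r = fun t => edgeLen e₂ e₃ a (v₂ + t * d₂) (v₃ + t * d₃))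
    (hadm : r 1 < p 1 + q 1 ∧ q 1 < p 1 + r 1 ∧ p 1 < q 1 + r 1) :
    angleSum d₁ d₂ d₃ (p 1) (q 1) (r 1) ≤ angleSum d₁ d₂ d₃ (p 0) (q 0) (r 0) ∧
      (angleSum d₁ d₂ d₃ (p 1) (q 1) (r 1) = angleSum d₁ d₂ d₃ (p 0) (q 0) (r 0) →
        d₁ = d₂ ∧ d₁ = d₃) := by
  have p0 t : 0 < p t := by rw [hp]; exact edgeLen_pos h₁ h₂ hc _ _
  have q0 t : 0 < q t := by rw [hq]; exact edgeLen_pos h₁ h₃ hb _ _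
  have r0 t : 0 < r t := by rw [hr]; exact edgeLen_pos h₂ h₃ ha _ _
  have pd t : HasDerivAt p (p t * edgeLogDeriv e₁ e₂ c (exp (v₁ + t * d₁)) (exp (v₂ + t * d₂))
      d₁ d₂) t := by rw [hp]; exact hasDerivAt_edgeLen h₁ h₂ hc _ _ _ _ _
  have qd t : HasDerivAt q (q t * edgeLogDeriv e₁ e₃ b (exp (v₁ + t * d₁)) (exp (v₃ + t * d₃))
      d₁ d₃) t := by rw [hq]; exact hasDerivAt_edgeLen h₁ h₃ hb _ _ _ _ _
  have rd t : HasDerivAt r (r t * edgeLogDeriv e₂ e₃ a (exp (v₂ + t * d₂)) (exp (v₃ + t * d₃))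
      d₂ d₃) t := by rw [hr]; exact hasDerivAt_edgeLen h₂ h₃ ha _ _ _ _ _
  have p2 t : p t ^ 2 = e₁ * exp (v₁ + t * d₁) ^ 2 + e₂ * exp (v₂ + t * d₂) ^ 2 +
      2 * c * (exp (v₁ + t * d₁) * exp (v₂ + t * d₂)) := by rw [hp]; exact edgeLen_sq h₁ h₂ hc _ _
  have q2 t : q t ^ 2 = e₁ * exp (v₁ + t * d₁) ^ 2 + e₃ * exp (v₃ + t * d₃) ^ 2 +
      2 * b * (exp (v₁ + t * d₁) * exp (v₃ + t * d₃)) := by rw [hq]; exact edgeLen_sq h₁ h₃ hb _ _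
  have r2 t : r t ^ 2 = e₂ * exp (v₂ + t * d₂) ^ 2 + e₃ * exp (v₃ + t * d₃) ^ 2 +
      2 * a * (exp (v₂ + t * d₂) * exp (v₃ + t * d₃)) := by rw [hr]; exact edgeLen_sq h₂ h₃ ha _ _
  have pc : Continuous p := continuous_iff_continuousAt.2 fun t => (pd t).continuousAt
  have qc : Continuous q := continuous_iff_continuousAt.2 fun t => (qd t).continuousAt
  have rc : Continuous r := continuous_iff_continuousAt.2 fun t => (rd t).continuousAt
  set O : Set ℝ := {t | r t < p t + q t ∧ q t < p t + r t ∧ p t < q t + r t}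
  have hO : IsOpen O := (isOpen_lt rc (pc.add qc)).inter
    ((isOpen_lt qc (pc.add rc)).inter (isOpen_lt pc (qc.add rc)))
  set g : ℝ → ℝ := fun t => angleSum d₁ d₂ d₃ (p t) (q t) (r t)
  have angc {p q r : ℝ → ℝ} (pc : Continuous p) (qc : Continuous q) (rc : Continuous r)
      (p0 : ∀ t, 0 < p t) (q0 : ∀ t, 0 < q t) :
      Continuous fun t => triAngle (p t) (q t) (r t) := by
    unfold triAngle
    refine continuous_arccos.comp (Continuous.div (by fun_prop) (by fun_prop) fun t => ?_)
    have := p0 t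
    have := q0 t
    positivity
  have hgc : Continuous g :=
    (((angc pc qc rc p0 q0).const_mul d₁).add ((angc pc rc qc p0 r0).const_mul d₂)).add
      ((angc qc rc pc q0 r0).const_mul d₃)
  have hmain : ∀ t ∈ O, ∃ g' : ℝ, HasDerivAt g g' t ∧ g' ≤ 0 ∧ (g' = 0 → d₁ = d₂ ∧ d₁ = d₃) := by
    rintro t ⟨t1, t2, t3⟩
    have hh := heron_pos (p0 t) t1 t2 t3
    have hh₂ : heron (p t) (r t) (q t) = heron (p t) (q t) (r t) := by unfold heron; ring
    have hh₃ : heron (q t) (r t) (p t) = heron (p t) (q t) (r t) := by unfold heron; ring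
    have D₁ := hasDerivAt_triAngle (p0 t) (q0 t) hh (pd t) (qd t) (rd t)
    have D₂ := hasDerivAt_triAngle (p0 t) (r0 t) (hh₂ ▸ hh) (pd t) (rd t) (qd t)
    have D₃ := hasDerivAt_triAngle (q0 t) (r0 t) (hh₃ ▸ hh) (qd t) (rd t) (pd t)
    rw [hh₂] at D₂
    rw [hh₃] at D₃
    have D := ((D₁.const_mul d₁).add (D₂.const_mul d₂)).add (D₃.const_mul d₃)
    have hs : 0 < √(heron (p t) (q t) (r t)) := Real.sqrt_pos.2 hh
    have pp := pow_pos (p0 t) 2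
    have qq := pow_pos (q0 t) 2
    have rr := pow_pos (r0 t) 2
    have hid := angle_variation_eq d₁ d₂ d₃ (p2 t) (q2 t) (r2 t) pp qq rr rfl rfl rfl
    set x := exp (v₁ + t * d₁)
    set y := exp (v₂ + t * d₂)
    set z := exp (v₃ + t * d₃)
    have x0 : 0 < x := exp_pos _
    have y0 : 0 < y := exp_pos _
    have z0 : 0 < z := exp_pos _
    have hsum := centerCoord_sum_eq e₁ e₂ e₃ a b c x y z
    have hmin := centerCoord_minor_eq e₁ e₂ e₃ a b c x y z
    have hN := minor_factor_pos x0 y0 z0 h₁ h₂ h₃ hc hb ha g₁ g₂ g₃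
    rw [← p2 t, ← q2 t, ← r2 t] at hsum hmin
    unfold heron at hh
    rw [← hsum] at hh
    have hE := mul_pos hh (mul_pos (mul_pos (mul_pos x0 y0) z0) hN)
    rw [← hmin] at hE
    obtain ⟨m1, m2⟩ := laplacian_minors_pos pp qq rr (by linarith) hE (hsum ▸ hh)
    obtain ⟨n1, n2⟩ := triangle_form_nonneg m1 m2 d₁ d₂ d₃
    rw [← mul_div_assoc, ← mul_div_assoc, ← mul_div_assoc, ← add_div, ← add_div, hid] at D
    refine ⟨_, D, ?_, ?_⟩
    · exact div_nonpos_of_nonpos_of_nonneg (neg_nonpos.2 n1) hs.le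
    · intro h
      rw [div_eq_zero_iff, or_iff_left hs.ne', neg_eq_zero] at h
      exact n2 h
  choose! g' hg' hneg hzero using hmain
  have hfin : (((fun s : ℝ × ℝ × ℝ => d₁ * s.1 + d₂ * s.2.1 + d₃ * s.2.2) ''
      (({0, π} : Set ℝ) ×ˢ ({0, π} : Set ℝ) ×ˢ ({0, π} : Set ℝ)))).Finite :=
    Set.Finite.image _ ((Set.toFinite _).prod ((Set.toFinite _).prod (Set.toFinite _)))
  have hanti : Antitone g := by
    refine antitone_of_hasDerivAt_nonpos_of_finite_image_compl hgc hO hfin hg' hneg ?_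
    intro t ht
    refine ⟨(triAngle (p t) (q t) (r t), triAngle (p t) (r t) (q t), triAngle (q t) (r t) (p t)),
      ⟨triAngle_mem_of_degenerate (p0 t) (q0 t) (r0 t) ht,
        triAngle_mem_of_degenerate (p0 t) (r0 t) (q0 t) fun h => ht ⟨h.2.1, h.1, ?_⟩,
        triAngle_mem_of_degenerate (q0 t) (r0 t) (p0 t) fun h => ht ⟨?_, ?_, h.1⟩⟩, rfl⟩ <;>
    linarith [h.1, h.2.1, h.2.2]
  refine ⟨hanti zero_le_one, fun heq => hzero 1 hadm ?_⟩
  have hconst : ∀ t ∈ Set.Icc (0 : ℝ) 1, g t = g 1 := fun t ht =>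
    le_antisymm ((hanti ht.1).trans heq.ge) (hanti ht.2)
  have hd1 := (hg' 1 hadm).hasDerivWithinAt (s := Set.Icc 0 1)
  have hd2 : HasDerivWithinAt g 0 (Set.Icc 0 1) 1 :=
    (hasDerivWithinAt_const (1 : ℝ) (Set.Icc (0 : ℝ) 1) (g 1)).congr hconst rfl
  exact (uniqueDiffOn_Icc_zero_one 1 (by simp)).eq_deriv _ hd1 hd2

namespace TriSurface

variable {N : ℕ} {S : TriSurface N}

theorem lE_comm (W : Weights S) (u : Fin N → ℝ) (i j : Fin N) : lE W u i j = lE W u j i := by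
  have := edgeLen_comm (W.eps i) (W.eps j) (W.eta i j) (u i) (u j)
  rw [W.eta_symm i j] at this
  rw [lE, W.eta_symm i j]
  exact this

theorem structCond1_of_mem (W : Weights S) {σ : Finset (Fin N)} (hσ : σ ∈ S.F) {i j : Fin N}
    (hi : i ∈ σ) (hj : j ∈ σ) (hij : i ≠ j) : 0 < W.eps i * W.eps j + W.eta i j := by
  refine W.structCond1 i j (Finset.mem_biUnion.2 ⟨σ, hσ, Finset.mem_powersetCard.2 ⟨?_, ?_⟩⟩)
  · simp [Finset.insert_subset_iff, hi, hj]
  · exact Finset.card_pair hij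

theorem lE_pos (W : Weights S) (u : Fin N → ℝ) {σ : Finset (Fin N)} (hσ : σ ∈ S.F) {i j : Fin N}
    (hi : i ∈ σ) (hj : j ∈ σ) (hij : i ≠ j) : 0 < lE W u i j :=
  edgeLen_pos (W.eps01 i) (W.eps01 j) (structCond1_of_mem W hσ hi hj hij) _ _

theorem thetaExE_eq (W : Weights S) (u : Fin N → ℝ) {i j k : Fin N} (hij : 0 < lE W u i j)
    (hik : 0 < lE W u i k) (hjk : 0 < lE W u j k) :
    thetaExE W u i j k = triAngle (lE W u i j) (lE W u i k) (lE W u j k) := by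
  unfold thetaExE
  split_ifs with h1 h2
  · rfl
  · exact (triAngle_eq_pi hij hik h2).symm
  · have := triAngle_mem_of_degenerate hij hik hjk (by tauto)
    by_cases h3 : lE W u i k + lE W u j k ≤ lE W u i j
    · exact (triAngle_eq_zero hij hik hjk h3).symm
    · rw [triAngle_comm]
      refine (triAngle_eq_zero hik hij hjk ?_).symm
      by_contra h4
      exact h1 ⟨not_le.1 h2, not_le.1 h4, not_le.1 h3⟩

theorem faceAngleExE_eq (W : Weights S) (u : Fin N → ℝ) {i j k : Fin N} (hij : i ≠ j)
    (hik : i ≠ k) (hjk : j ≠ k) {σ : Finset (Fin N)} (hσ : σ = {i, j, k}) (hF : σ ∈ S.F) :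
    faceAngleExE W u i σ = triAngle (lE W u i j) (lE W u i k) (lE W u j k) := by
  classical
  have hi : i ∈ σ := by simp [hσ]
  have hj : j ∈ σ := by simp [hσ]
  have hk : k ∈ σ := by simp [hσ]
  have h1 : σ.erase i = {j, k} := by
    subst hσ; ext x; simp only [Finset.mem_erase, Finset.mem_insert, Finset.mem_singleton]; grind
  have h2 : ({j, k} : Finset (Fin N)).erase j = {k} := by
    ext x; simp only [Finset.mem_erase, Finset.mem_insert, Finset.mem_singleton]; grind
  have h3 : ({j, k} : Finset (Fin N)).erase k = {j} := by
    ext x; simp only [Finset.mem_erase, Finset.mem_insert, Finset.mem_singleton]; grind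
  have ij := lE_pos W u hF hi hj hij
  have ik := lE_pos W u hF hi hk hik
  have jk := lE_pos W u hF hj hk hjk
  have kj := lE_pos W u hF hk hj hjk.symm
  have e : faceAngleExE W u i σ = 1 / 2 * (thetaExE W u i j k + thetaExE W u i k j) := by
    unfold faceAngleExE
    congr 1
    convert (rfl : ∑ j ∈ σ.erase i, ∑ k ∈ (σ.erase i).erase j, thetaExE W u i j k = _)
    rw [h1, Finset.sum_pair hjk, h2, h3, Finset.sum_singleton, Finset.sum_singleton]
  rw [e, thetaExE_eq W u ij ik jk, thetaExE_eq W u ik ij kj, lE_comm W u k j,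
    triAngle_comm (lE W u i k)]
  ring

/-- Monotonicity of the extended angles of a face with respect to the conformal factors. -/
theorem face_sum_nonpos (W : Weights S) {uA uB : Fin N → ℝ} (hA : admissibleE W uA)
    {σ : Finset (Fin N)} (hF : σ ∈ S.F) :
    ∑ i ∈ σ, (faceAngleExE W uA i σ - faceAngleExE W uB i σ) * (uA i - uB i) ≤ 0 ∧
      (∑ i ∈ σ, (faceAngleExE W uA i σ - faceAngleExE W uB i σ) * (uA i - uB i) = 0 →
        ∀ i ∈ σ, ∀ j ∈ σ, uA i - uB i = uA j - uB j) := by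
  obtain ⟨i, j, k, hij, hik, hjk, hσ⟩ := Finset.card_eq_three.1 (S.card_face σ hF)
  have hσj : σ = {j, i, k} := by rw [hσ, Finset.insert_comm]
  have hσk : σ = {k, i, j} := by
    rw [hσ]; ext x; simp only [Finset.mem_insert, Finset.mem_singleton]; tauto
  have hi : i ∈ σ := by simp [hσ]
  have hj : j ∈ σ := by simp [hσ]
  have hk : k ∈ σ := by simp [hσ]
  have hsum : ∀ f : Fin N → ℝ, ∑ m ∈ σ, f m = f i + f j + f k := fun f => by
    rw [hσ, Finset.sum_insert (by simp [hij, hik]), Finset.sum_pair hjk, add_assoc]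
  have E (u : Fin N → ℝ) := faceAngleExE_eq W u hij hik hjk hσ hF
  have Ej (u : Fin N → ℝ) := faceAngleExE_eq W u hij.symm hjk hik hσj hF
  have Ek (u : Fin N → ℝ) := faceAngleExE_eq W u hik.symm hjk.symm hij hσk hF
  have a1 := hA i j k (hσ ▸ hF)
  have a2 := hA j i k (hσj ▸ hF)
  have a3 := hA k i j (hσk ▸ hF)
  have s1 := W.structCond2 i j k (hσ ▸ hF) hij hik hjk
  have s2 := W.structCond2 j i k (hσj ▸ hF) hij.symm hjk hik
  have s3 := W.structCond2 k i j (hσk ▸ hF) hik.symm hjk.symm hij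
  rw [W.eta_symm j i] at s2
  rw [W.eta_symm k i, W.eta_symm k j] at s3
  rw [lE_comm W uA j i] at a2
  rw [lE_comm W uA k i, lE_comm W uA k j] at a3
  have key := face_angle_monotone (W.eps01 i) (W.eps01 j) (W.eps01 k)
    (structCond1_of_mem W hF hi hj hij) (structCond1_of_mem W hF hi hk hik)
    (structCond1_of_mem W hF hj hk hjk) (by linarith) (by linarith) (by linarith)
    (uB i) (uB j) (uB k) (uA i - uB i) (uA j - uB j) (uA k - uB k) rfl rfl rfl
  simp only [one_mul, zero_mul, add_zero, add_sub_cancel] at key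
  have key2 := key ⟨a1, a2, by
    have : lE W uA i j < lE W uA i k + lE W uA j k := a3
    exact this⟩
  have hval : ∑ m ∈ σ, (faceAngleExE W uA m σ - faceAngleExE W uB m σ) * (uA m - uB m) =
      angleSum (uA i - uB i) (uA j - uB j) (uA k - uB k) (lE W uA i j) (lE W uA i k) (lE W uA j k) -
      angleSum (uA i - uB i) (uA j - uB j) (uA k - uB k) (lE W uB i j) (lE W uB i k)
        (lE W uB j k) := by
    rw [hsum, E, E, Ej, Ej, Ek, Ek]
    simp only [lE_comm W _ j i, lE_comm W _ k i, lE_comm W _ k j]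
    unfold angleSum
    ring
  rw [hval]
  refine ⟨sub_nonpos.2 key2.1, fun h => ?_⟩
  obtain ⟨hd1, hd2⟩ := key2.2 (sub_eq_zero.1 h)
  have hall : ∀ m ∈ σ, uA m - uB m = uA i - uB i := by
    intro m hm
    rw [hσ] at hm
    simp only [Finset.mem_insert, Finset.mem_singleton] at hm
    rcases hm with rfl | rfl | rfl
    · rfl
    · exact hd1.symm
    · exact hd2.symm
  intro m hm n hn
  rw [hall m hm, hall n hn]

theorem sum_curvature_sub_eq (W : Weights S) (uA uB : Fin N → ℝ) :
    ∑ i, (KExE W uA i - KExE W uB i) * (uA i - uB i) =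
      -∑ σ ∈ S.F, ∑ i ∈ σ, (faceAngleExE W uA i σ - faceAngleExE W uB i σ) * (uA i - uB i) := by
  classical
  have h (i : Fin N) : (KExE W uA i - KExE W uB i) * (uA i - uB i) =
      -∑ σ ∈ S.F, if i ∈ σ then
        (faceAngleExE W uA i σ - faceAngleExE W uB i σ) * (uA i - uB i) else 0 := by
    rw [← Finset.sum_filter, ← Finset.sum_mul, Finset.sum_sub_distrib]
    have e (u : Fin N → ℝ) :
        KExE W u i = 2 * π - ∑ σ ∈ S.F with i ∈ σ, faceAngleExE W u i σ := by
      unfold KExE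
      congr!
    rw [e uA, e uB]
    ring
  simp_rw [h]
  rw [Finset.sum_neg_distrib, Finset.sum_comm]
  congr 1
  refine Finset.sum_congr rfl fun σ _ => ?_
  rw [← Finset.sum_filter]
  refine Finset.sum_congr ?_ fun _ _ => rfl
  ext i
  simp

theorem eq_of_face_eq (S : TriSurface N) {f : Fin N → ℝ}
    (h : ∀ σ ∈ S.F, ∀ i ∈ σ, ∀ j ∈ σ, f i = f j) (i j : Fin N) : f i = f j := by
  obtain ⟨w⟩ := S.connected.preconnected i j
  induction w with
  | nil => rfl
  | cons hadj _ ih =>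
    rw [← ih]
    rw [SimpleGraph.fromRel_adj] at hadj
    obtain ⟨_, ⟨σ, hσ, h1, h2⟩ | ⟨σ, hσ, h1, h2⟩⟩ := hadj
    · exact h σ hσ _ h1 _ h2
    · exact h σ hσ _ h2 _ h1

theorem KExE_eq (W : Weights S) {α : ℝ} {u : Fin N → ℝ} {i : Fin N} {R : ℝ}
    (h : RExE W α u i = R) : KExE W u i = R * exp (α * u i) := by
  rw [← h, RExE, mul_assoc, ← exp_add, neg_add_cancel, exp_zero, mul_one]

end TriSurface

theorem exp_sub_mul_sub_nonneg (x y : ℝ) : 0 ≤ (exp x - exp y) * (x - y) := by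
  rcases le_total x y with h | h
  · exact mul_nonneg_of_nonpos_of_nonpos (sub_nonpos.2 (exp_le_exp.2 h)) (sub_nonpos.2 h)
  · exact mul_nonneg (sub_nonneg.2 (exp_le_exp.2 h)) (sub_nonneg.2 h)

theorem curvature_term_eq (α R x y : ℝ) :
    α ^ 2 * ((R * exp (α * x) - R * exp (α * y)) * (x - y)) =
      α * R * ((exp (α * x) - exp (α * y)) * (α * x - α * y)) := by
  ring

theorem curvature_term_nonpos {α R : ℝ} (h : α * R ≤ 0) (x y : ℝ) :
    (R * exp (α * x) - R * exp (α * y)) * (x - y) ≤ 0 := by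
  rcases eq_or_ne α 0 with rfl | hα
  · simp
  · have h1 := mul_nonpos_of_nonpos_of_nonneg h (exp_sub_mul_sub_nonneg (α * x) (α * y))
    rw [← curvature_term_eq] at h1
    exact nonpos_of_mul_nonpos_right h1 (by positivity)

theorem eq_of_curvature_term_eq_zero {α R : ℝ} (h : α * R < 0) {x y : ℝ}
    (h0 : (R * exp (α * x) - R * exp (α * y)) * (x - y) = 0) : x = y := by
  have hα : α ≠ 0 := by rintro rfl; simp at h
  have hR : R ≠ 0 := by rintro rfl; simp at h
  rcases mul_eq_zero.1 h0 with h1 | h1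
  · have := exp_injective (mul_left_cancel₀ hR (sub_eq_zero.1 h1))
    exact mul_left_cancel₀ hα this
  · exact sub_eq_zero.1 h1

/-- Euclidean rigidity of the extended combinatorial `α`-curvature.
If `u_A` is admissible, `u_B` is arbitrary, and both have the same extended combinatorial
`α`-curvature `R̄`, then: if `α R̄ ≡ 0` they differ by a constant vector `c(1,…,1)`;
if `α R̄ ≤ 0` and `α R̄ ≢ 0` they are equal. -/
theorem euclidean_alpha_rigidity {N : ℕ} (S : TriSurface N) (W : TriSurface.Weights S)
    (α : ℝ) (Rbar : Fin N → ℝ) (uA uB : Fin N → ℝ)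
    (hA : admissibleE W uA)
    (hRA : ∀ i, RExE W α uA i = Rbar i) (hRB : ∀ i, RExE W α uB i = Rbar i) :
    ((∀ i, α * Rbar i = 0) → ∃ c : ℝ, uB = fun i => uA i + c) ∧
    ((∀ i, α * Rbar i ≤ 0) → (∃ i, α * Rbar i < 0) → uA = uB) := by
  have main : (∀ i, α * Rbar i ≤ 0) →
      (∀ i j, uA i - uB i = uA j - uB j) ∧ ∀ i, α * Rbar i < 0 → uA i = uB i := by
    intro hR
    have hsum := sum_curvature_sub_eq W uA uB
    have hface : ∀ σ ∈ S.F,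
        ∑ i ∈ σ, (faceAngleExE W uA i σ - faceAngleExE W uB i σ) * (uA i - uB i) ≤ 0 :=
      fun σ hσ => (face_sum_nonpos W hA hσ).1
    have hterm : ∀ i ∈ Finset.univ, (KExE W uA i - KExE W uB i) * (uA i - uB i) ≤ 0 := by
      intro i _
      rw [KExE_eq W (hRA i), KExE_eq W (hRB i)]
      exact curvature_term_nonpos (hR i) _ _
    have h1 := Finset.sum_nonpos hface
    have h2 := Finset.sum_nonpos hterm
    have h3 := (Finset.sum_eq_zero_iff_of_nonpos hface).1 (by linarith)
    have h4 := (Finset.sum_eq_zero_iff_of_nonpos hterm).1 (by linarith)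
    refine ⟨eq_of_face_eq S fun σ hσ => (face_sum_nonpos W hA hσ).2 (h3 σ hσ), fun i hi => ?_⟩
    have := h4 i (Finset.mem_univ i)
    rw [KExE_eq W (hRA i), KExE_eq W (hRB i)] at this
    exact eq_of_curvature_term_eq_zero hi this
  constructor
  · intro h
    obtain ⟨i₀⟩ := S.connected.nonempty
    refine ⟨uB i₀ - uA i₀, funext fun i => ?_⟩
    linarith [(main fun i => (h i).le).1 i i₀]
  · rintro h ⟨i₀, hi₀⟩
    obtain ⟨hconst, heq⟩ := main h
    funext i
    linarith [hconst i i₀, heq i₀ hi₀]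
end
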